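/- Let M ≥ 1 be an integer, τ > 0, λ ∈ (0,1), and r̃ ∈ ℂ^M. Then the denominator m(r̃) = (1−λ)·φ_{τ²}^{(M)}(r̃) + λ·∫_{ℂ^M} q_M(r)·φ_{τ²}^{(M)}(r̃−r) dr is strictly positive and the Bayes posterior mean satisfies (λ·∫_{ℂ^M} r·q_M(r)·φ_{τ²}^{(M)}(r̃−r) dr) / m(r̃) = r̃·ν_M(‖r̃‖²)/ξ_M(‖r̃‖²). -/

import Mathlib

open MeasureTheory Set
open scoped ENNReal

noncomputable section

/-- `Q(g) = ∫_{b ln g + c}^∞ exp(-s²) ds`. -/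
def Qfun (b c g : ℝ) : ℝ := ∫ s in Set.Ioi (b * Real.log g + c), Real.exp (-s ^ 2)

/-- Squared Euclidean norm on `ℂ^M ≅ ℝ^{2M}`. -/
def nsq {M : ℕ} (r : Fin M → ℂ) : ℝ := ∑ i, ‖r i‖ ^ 2

/-- Circularly symmetric complex Gaussian density of variance `v` on `ℂ^M ≅ ℝ^{2M}`:
`φ_v^{(M)}(r) = (πv)^{-M} exp(-‖r‖²/v)`. -/
def vgauss (M : ℕ) (v : ℝ) (r : Fin M → ℂ) : ℝ :=
  ((Real.pi * v) ^ M)⁻¹ * Real.exp (-nsq r / v)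

/-- Channel-row density `q_M(r) = a π^{-M} ∫₀^∞ g^{-γ-2M} Q(g) exp(-‖r‖²/g²) dg`. -/
def qM (a γ b c : ℝ) (M : ℕ) (r : Fin M → ℂ) : ℝ :=
  a / Real.pi ^ M *
    ∫ g in Set.Ioi (0 : ℝ), g ^ (-γ - 2 * (M : ℝ)) * Qfun b c g * Real.exp (-nsq r / g ^ 2)

/-- `ν_i(s) = ∫₀^∞ g^{2-γ} Q(g) (g²+τ²)^{-(i+1)} exp(-s/(g²+τ²)) dg`. -/
def nufun (γ b c τ : ℝ) (i : ℕ) (s : ℝ) : ℝ :=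
  ∫ g in Set.Ioi (0 : ℝ),
    g ^ (2 - γ) * Qfun b c g / (g ^ 2 + τ ^ 2) ^ (i + 1) * Real.exp (-s / (g ^ 2 + τ ^ 2))

/-- `ξ_i(s) = ((1-λ)/(λ a τ^{2i})) exp(-s/τ²) + ∫₀^∞ g^{-γ} Q(g) (g²+τ²)^{-i} exp(-s/(g²+τ²)) dg`. -/
def xifun (a γ b c τ lam : ℝ) (i : ℕ) (s : ℝ) : ℝ :=
  (1 - lam) / (lam * a * τ ^ (2 * i)) * Real.exp (-s / τ ^ 2) +
    ∫ g in Set.Ioi (0 : ℝ),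
      g ^ (-γ) * Qfun b c g / (g ^ 2 + τ ^ 2) ^ i * Real.exp (-s / (g ^ 2 + τ ^ 2))

section GaussianTail

theorem integrable_exp_neg_sq : Integrable fun s : ℝ => Real.exp (-s ^ 2) := by
  simpa using integrable_exp_neg_mul_sq (b := 1) one_pos

theorem antitone_integral_Ioi_exp_neg_sq :
    Antitone fun x : ℝ => ∫ s in Ioi x, Real.exp (-s ^ 2) := fun _ _ h =>
  setIntegral_mono_set integrable_exp_neg_sq.integrableOn
    (Filter.Eventually.of_forall fun _ => (Real.exp_pos _).le) (Ioi_subset_Ioi h).eventuallyLE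

theorem integral_Ioi_exp_neg_sq_le {k : ℝ} (hk : 0 < k) (x : ℝ) :
    ∫ s in Ioi x, Real.exp (-s ^ 2) ≤ Real.exp (k ^ 2 / 4) * (Real.exp (-k * x) / k) := by
  have h : ∫ s in Ioi x, Real.exp (k ^ 2 / 4) * Real.exp (-k * s) =
      Real.exp (k ^ 2 / 4) * (Real.exp (-k * x) / k) := by
    rw [integral_const_mul, integral_exp_mul_Ioi (by linarith)]
    field_simp
  rw [← h]
  refine integral_mono integrable_exp_neg_sq.integrableOn
    ((integrableOn_exp_mul_Ioi (by linarith) x).const_mul _) fun s => ?_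
  rw [← Real.exp_add]
  exact Real.exp_le_exp.2 (by nlinarith [sq_nonneg (s - k / 2)])

theorem Qfun_nonneg (b c g : ℝ) : 0 ≤ Qfun b c g :=
  integral_nonneg fun _ => (Real.exp_pos _).le

theorem measurable_Qfun (b c : ℝ) : Measurable (Qfun b c) :=
  antitone_integral_Ioi_exp_neg_sq.measurable.comp
    ((Real.measurable_log.const_mul b).add_const c)

theorem Qfun_le_integral (b c g : ℝ) : Qfun b c g ≤ ∫ s, Real.exp (-s ^ 2) :=
  setIntegral_le_integral integrable_exp_neg_sq
    (Filter.Eventually.of_forall fun _ => (Real.exp_pos _).le)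

theorem exists_Qfun_le_mul_rpow {b : ℝ} (hb : b < 0) (c : ℝ) {p : ℝ} (hp : 0 < p) :
    ∃ C, ∀ g, 0 < g → Qfun b c g ≤ C * g ^ p := by
  have hk : 0 < p / -b := div_pos hp (by linarith)
  refine ⟨Real.exp ((p / -b) ^ 2 / 4) * (Real.exp (-(p / -b) * c) / (p / -b)), fun g hg => ?_⟩
  refine (integral_Ioi_exp_neg_sq_le hk _).trans_eq ?_
  have h : -(p / -b) * (b * Real.log g + c) = -(p / -b) * c + Real.log g * p := by
    field_simp [hb.ne]
    ring
  rw [h, Real.exp_add, Real.rpow_def_of_pos hg]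
  ring

theorem integrableOn_rpow_neg_mul_Qfun {b : ℝ} (hb : b < 0) (c : ℝ) {γ : ℝ} (hγ : 1 < γ) :
    IntegrableOn (fun g => g ^ (-γ) * Qfun b c g) (Ioi 0) := by
  have hmeas : Measurable fun g : ℝ => g ^ (-γ) * Qfun b c g :=
    (measurable_id.pow_const _).mul (measurable_Qfun b c)
  rw [← Ioc_union_Ioi_eq_Ioi (zero_le_one' ℝ)]
  refine IntegrableOn.union ?_ ?_
  · obtain ⟨C, hC⟩ := exists_Qfun_le_mul_rpow hb c (zero_lt_one.trans hγ)
    refine Integrable.mono' (g := fun _ => C) (integrable_const _) hmeas.aestronglyMeasurable ?_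
    refine (ae_restrict_mem measurableSet_Ioc).mono fun g hg => ?_
    have hpos : 0 < g ^ (-γ) := Real.rpow_pos_of_pos hg.1 _
    rw [Real.norm_of_nonneg (mul_nonneg hpos.le (Qfun_nonneg b c g))]
    refine (mul_le_mul_of_nonneg_left (hC g hg.1) hpos.le).trans_eq ?_
    rw [mul_left_comm, ← Real.rpow_add hg.1]
    simp
  · refine Integrable.mono' ((integrableOn_Ioi_rpow_of_lt (a := -γ) (by linarith)
      one_pos).mul_const (∫ s, Real.exp (-s ^ 2))) hmeas.aestronglyMeasurable ?_
    refine (ae_restrict_mem measurableSet_Ioi).mono fun g hg => ?_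
    have hpos : 0 < g ^ (-γ) := Real.rpow_pos_of_pos (zero_lt_one.trans hg) _
    rw [Real.norm_of_nonneg (mul_nonneg hpos.le (Qfun_nonneg b c g))]
    exact mul_le_mul_of_nonneg_left (Qfun_le_integral b c g) hpos.le

end GaussianTail

section ComplexGaussian

variable {M : ℕ}

theorem nsq_nonneg (r : Fin M → ℂ) : 0 ≤ nsq r :=
  Finset.sum_nonneg fun _ _ => sq_nonneg _

theorem nsq_neg (r : Fin M → ℂ) : nsq (-r) = nsq r := by
  simp [nsq]

theorem continuous_nsq : Continuous (nsq : (Fin M → ℂ) → ℝ) := by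
  unfold nsq
  fun_prop

theorem norm_sq_le_nsq (r : Fin M → ℂ) : ‖r‖ ^ 2 ≤ nsq r := by
  have h : ‖r‖ ≤ √(nsq r) := (pi_norm_le_iff_of_nonneg (Real.sqrt_nonneg _)).2 fun i =>
    Real.le_sqrt_of_sq_le
      (Finset.single_le_sum (f := fun i => ‖r i‖ ^ 2) (fun _ _ => sq_nonneg _) (Finset.mem_univ i))
  exact (Real.le_sqrt (norm_nonneg r) (nsq_nonneg r)).1 h

theorem exp_neg_nsq_div_le_one {v : ℝ} (hv : 0 < v) (r : Fin M → ℂ) :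
    Real.exp (-nsq r / v) ≤ 1 :=
  Real.exp_le_one_iff.2 (div_nonpos_of_nonpos_of_nonneg (by linarith [nsq_nonneg r]) hv.le)

theorem exp_neg_nsq_div_mul_norm_le {v : ℝ} (hv : 0 < v) (r : Fin M → ℂ) :
    Real.exp (-nsq r / v) * ‖r‖ ≤ 1 + v := by
  have hnorm : ‖r‖ ≤ 1 + nsq r := by nlinarith [norm_sq_le_nsq r, sq_nonneg (‖r‖ - 1 / 2)]
  have hexp := Real.exp_pos (-nsq r / v)
  have hlin : Real.exp (-nsq r / v) * nsq r ≤ v := by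
    have h : nsq r / v ≤ Real.exp (nsq r / v) := by linarith [Real.add_one_le_exp (nsq r / v)]
    rw [div_le_iff₀ hv] at h
    rw [neg_div, Real.exp_neg, inv_mul_le_iff₀ (Real.exp_pos _)]
    exact h
  nlinarith [exp_neg_nsq_div_le_one hv r, mul_le_mul_of_nonneg_left hnorm hexp.le]

theorem vgauss_pos {v : ℝ} (hv : 0 < v) (r : Fin M → ℂ) : 0 < vgauss M v r := by
  have := Real.pi_pos
  unfold vgauss
  positivity

theorem continuous_vgauss (v : ℝ) : Continuous (vgauss M v) := by
  have := continuous_nsq (M := M)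
  unfold vgauss
  fun_prop

theorem vgauss_eq_prod (v : ℝ) (r : Fin M → ℂ) :
    vgauss M v r = ∏ i, (Real.pi * v)⁻¹ * Real.exp (-v⁻¹ * ‖r i‖ ^ 2) := by
  rw [Finset.prod_mul_distrib, ← Real.exp_sum, ← Finset.mul_sum]
  simp only [vgauss, nsq, Finset.prod_const, Finset.card_univ, Fintype.card_fin, inv_pow]
  congr 2
  ring

theorem integral_vgauss {v : ℝ} (hv : 0 < v) : ∫ r, vgauss M v r = 1 := by
  simp_rw [vgauss_eq_prod]
  rw [integral_fintype_prod_volume_eq_pow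
    (fun z : ℂ => (Real.pi * v)⁻¹ * Real.exp (-v⁻¹ * ‖z‖ ^ 2)), integral_const_mul,
    GaussianFourier.integral_rexp_neg_mul_sq_norm (inv_pos.2 hv)]
  have := Real.pi_pos.ne'
  simp [Complex.finrank_real_complex]
  field_simp
  simp

theorem integrable_vgauss {v : ℝ} (hv : 0 < v) : Integrable (vgauss M v) :=
  Integrable.of_integral_ne_zero (by simp [integral_vgauss hv])

theorem integrable_vgauss_smul_id {v : ℝ} (hv : 0 < v) :
    Integrable fun r : Fin M → ℂ => vgauss M v r • r := by
  have hdecomp : ∀ r : Fin M → ℂ, vgauss M v r • r =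
      (2 ^ M * vgauss M (2 * v) r) • (Real.exp (-nsq r / (2 * v)) • r) := fun r => by
    rw [smul_smul]
    congr 1
    have he : Real.exp (-nsq r / v) =
        Real.exp (-nsq r / (2 * v)) * Real.exp (-nsq r / (2 * v)) := by
      rw [← Real.exp_add]
      congr 1
      field_simp
      ring
    have hpi := Real.pi_pos
    simp only [vgauss, he, mul_pow]
    field_simp
  simp_rw [hdecomp]
  have hcont := continuous_nsq (M := M)
  refine ((integrable_vgauss (M := M) (by positivity : 0 < 2 * v)).const_mul (2 ^ M)).smul_bdd
    (1 + 2 * v) (by fun_prop) (Filter.Eventually.of_forall fun r => ?_)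
  rw [norm_smul, Real.norm_of_nonneg (Real.exp_pos _).le]
  exact exp_neg_nsq_div_mul_norm_le (by positivity) r

theorem integral_vgauss_smul_id (v : ℝ) : ∫ r : Fin M → ℂ, vgauss M v r • r = 0 := by
  have h := integral_neg_eq_self (fun r : Fin M → ℂ => vgauss M v r • r) volume
  simp only [vgauss, nsq_neg, smul_neg, integral_neg] at h
  exact self_eq_neg.1 h.symm

theorem integral_vgauss_sub_smul_id {v : ℝ} (hv : 0 < v) (μ : Fin M → ℂ) :
    ∫ r : Fin M → ℂ, vgauss M v (r - μ) • r = μ := by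
  have h := integral_sub_right_eq_self (μ := volume)
    (fun r : Fin M → ℂ => vgauss M v r • (r + μ)) μ
  simp only [sub_add_cancel] at h
  simp_rw [h, smul_add]
  rw [integral_add (integrable_vgauss_smul_id hv) ((integrable_vgauss hv).smul_const μ),
    integral_vgauss_smul_id, integral_smul_const, integral_vgauss hv, zero_add, one_smul]

theorem nsq_div_add_nsq_sub_div {x y : ℝ} (hx : 0 < x) (hy : 0 < y) (s r : Fin M → ℂ) :
    nsq r / x + nsq (s - r) / y =
      nsq s / (x + y) + nsq (r - (x / (x + y)) • s) / (x * y / (x + y)) := by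
  simp only [nsq, Finset.sum_div, ← Finset.sum_add_distrib]
  refine Finset.sum_congr rfl fun i _ => ?_
  simp only [Complex.sq_norm, Complex.normSq_apply, Pi.sub_apply, Pi.smul_apply, Complex.sub_re,
    Complex.sub_im, Complex.real_smul, Complex.mul_re, Complex.mul_im, Complex.ofReal_re,
    Complex.ofReal_im]
  field_simp
  ring

theorem vgauss_mul_vgauss_sub {x y : ℝ} (hx : 0 < x) (hy : 0 < y) (s r : Fin M → ℂ) :
    vgauss M x r * vgauss M y (s - r) =
      vgauss M (x + y) s * vgauss M (x * y / (x + y)) (r - (x / (x + y)) • s) := by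
  have h := nsq_div_add_nsq_sub_div hx hy s r
  have he : Real.exp (-nsq r / x) * Real.exp (-nsq (s - r) / y) = Real.exp (-nsq s / (x + y)) *
      Real.exp (-nsq (r - (x / (x + y)) • s) / (x * y / (x + y))) := by
    simp only [← Real.exp_add, neg_div]
    congr 1
    linarith
  have hc : ((Real.pi * x) ^ M)⁻¹ * ((Real.pi * y) ^ M)⁻¹ =
      ((Real.pi * (x + y)) ^ M)⁻¹ * ((Real.pi * (x * y / (x + y))) ^ M)⁻¹ := by
    rw [← mul_inv, ← mul_inv, ← mul_pow, ← mul_pow]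
    congr 2
    field_simp
  simp only [vgauss]
  rw [mul_mul_mul_comm, he, hc, mul_mul_mul_comm]

theorem integral_vgauss_mul_vgauss_sub {x y : ℝ} (hx : 0 < x) (hy : 0 < y) (s : Fin M → ℂ) :
    ∫ r, vgauss M x r * vgauss M y (s - r) = vgauss M (x + y) s := by
  simp_rw [vgauss_mul_vgauss_sub hx hy]
  rw [integral_const_mul, integral_sub_right_eq_self (vgauss M (x * y / (x + y))),
    integral_vgauss (by positivity), mul_one]

theorem integral_vgauss_mul_vgauss_sub_smul_id {x y : ℝ} (hx : 0 < x) (hy : 0 < y)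
    (s : Fin M → ℂ) :
    ∫ r, (vgauss M x r * vgauss M y (s - r)) • r = (vgauss M (x + y) s * (x / (x + y))) • s := by
  simp_rw [vgauss_mul_vgauss_sub hx hy, mul_smul]
  rw [integral_smul, integral_vgauss_sub_smul_id (by positivity)]

theorem vgauss_sub_le {v : ℝ} (hv : 0 < v) (s r : Fin M → ℂ) :
    ‖vgauss M v (s - r)‖ ≤ ((Real.pi * v) ^ M)⁻¹ := by
  have := Real.pi_pos
  rw [Real.norm_of_nonneg (vgauss_pos hv _).le]
  exact mul_le_of_le_one_right (by positivity) (exp_neg_nsq_div_le_one hv _)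

theorem norm_vgauss_sub_smul_le {v : ℝ} (hv : 0 < v) (s r : Fin M → ℂ) :
    ‖vgauss M v (s - r) • r‖ ≤ ((Real.pi * v) ^ M)⁻¹ * (1 + v + ‖s‖) := by
  have hpi := Real.pi_pos
  rw [norm_smul, Real.norm_of_nonneg (vgauss_pos hv _).le, vgauss, mul_assoc]
  refine mul_le_mul_of_nonneg_left ?_ (by positivity)
  have hr : ‖r‖ ≤ ‖s - r‖ + ‖s‖ := by
    simpa [norm_sub_rev] using norm_add_le (r - s) s
  have h1 := mul_le_mul_of_nonneg_left hr (Real.exp_pos (-nsq (s - r) / v)).le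
  have h2 := exp_neg_nsq_div_mul_norm_le hv (s - r)
  have h3 := mul_le_mul_of_nonneg_right (exp_neg_nsq_div_le_one hv (s - r)) (norm_nonneg s)
  linarith

end ComplexGaussian

section ScaleMixture

variable {M : ℕ}

theorem integrable_mul_vgauss_sq {W : ℝ → ℝ} (hWm : Measurable W)
    (hW : IntegrableOn W (Ioi 0)) :
    Integrable (fun p : ℝ × (Fin M → ℂ) => W p.1 * vgauss M (p.1 ^ 2) p.2)
      ((volume.restrict (Ioi 0)).prod volume) := by
  have hmeas : Measurable fun p : ℝ × (Fin M → ℂ) => W p.1 * vgauss M (p.1 ^ 2) p.2 := by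
    have := (continuous_nsq (M := M)).measurable
    unfold vgauss
    fun_prop
  rw [integrable_prod_iff hmeas.aestronglyMeasurable]
  refine ⟨(ae_restrict_mem measurableSet_Ioi).mono fun g hg =>
    (integrable_vgauss (M := M) (pow_pos hg 2)).const_mul (W g), hW.norm.congr ?_⟩
  refine (ae_restrict_mem measurableSet_Ioi).mono fun g hg => ?_
  simp only [norm_mul, Real.norm_of_nonneg (vgauss_pos (M := M) (pow_pos hg 2) _).le]
  rw [integral_const_mul, integral_vgauss (pow_pos hg 2), mul_one]

theorem integral_mixture_smul {E : Type*} [NormedAddCommGroup E] [NormedSpace ℝ E]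
    [CompleteSpace E] {W : ℝ → ℝ} (hWm : Measurable W) (hW : IntegrableOn W (Ioi 0))
    {F : (Fin M → ℂ) → E} (hF : AEStronglyMeasurable F) {C : ℝ} (hC : ∀ r, ‖F r‖ ≤ C) :
    ∫ r, (∫ g in Ioi (0 : ℝ), W g * vgauss M (g ^ 2) r) • F r =
      ∫ g in Ioi (0 : ℝ), W g • ∫ r, vgauss M (g ^ 2) r • F r := by
  have hint : Integrable (fun p : ℝ × (Fin M → ℂ) => (W p.1 * vgauss M (p.1 ^ 2) p.2) • F p.2)
      ((volume.restrict (Ioi 0)).prod volume) :=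
    (integrable_mul_vgauss_sq hWm hW).smul_bdd C hF.comp_snd
      (Filter.Eventually.of_forall fun p => hC p.2)
  simp_rw [← integral_smul_const]
  rw [← integral_integral_swap (f := fun g r => (W g * vgauss M (g ^ 2) r) • F r) hint]
  simp_rw [mul_smul, integral_smul]

theorem qM_eq_integral_vgauss (a γ b c : ℝ) (r : Fin M → ℂ) :
    qM a γ b c M r =
      a * ∫ g in Ioi (0 : ℝ), g ^ (-γ) * Qfun b c g * vgauss M (g ^ 2) r := by
  have hpi := Real.pi_pos
  rw [qM, div_mul_eq_mul_div, mul_div_assoc, ← integral_div]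
  congr 1
  refine setIntegral_congr_fun measurableSet_Ioi fun g hg => ?_
  have hg : 0 < g := hg
  have hpow : g ^ (-γ - 2 * (M : ℝ)) = g ^ (-γ) / (g ^ 2) ^ M := by
    rw [Real.rpow_sub hg, ← pow_mul, ← Real.rpow_natCast g (2 * M)]
    push_cast
    rfl
  simp only [vgauss, hpow, mul_pow]
  field_simp

theorem qM_nonneg {a : ℝ} (ha : 0 ≤ a) (γ b c : ℝ) (r : Fin M → ℂ) : 0 ≤ qM a γ b c M r := by
  have hpi := Real.pi_pos
  refine mul_nonneg (by positivity) (setIntegral_nonneg measurableSet_Ioi fun g hg => ?_)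
  exact mul_nonneg (mul_nonneg (Real.rpow_pos_of_pos hg _).le (Qfun_nonneg b c g))
    (Real.exp_pos _).le

theorem integral_qM_mul_vgauss_sub (a : ℝ) {γ b τ : ℝ} (hγ : 1 < γ) (hb : b < 0) (c : ℝ)
    (hτ : 0 < τ) (s : Fin M → ℂ) :
    ∫ r, qM a γ b c M r * vgauss M (τ ^ 2) (s - r) =
      a / Real.pi ^ M * ∫ g in Ioi (0 : ℝ),
        g ^ (-γ) * Qfun b c g / (g ^ 2 + τ ^ 2) ^ M * Real.exp (-nsq s / (g ^ 2 + τ ^ 2)) := by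
  have hτ2 : 0 < τ ^ 2 := pow_pos hτ 2
  have h := integral_mixture_smul (M := M) (F := fun r => vgauss M (τ ^ 2) (s - r))
    ((measurable_id.pow_const (-γ)).mul (measurable_Qfun b c))
    (integrableOn_rpow_neg_mul_Qfun hb c hγ)
    ((continuous_vgauss _).comp (continuous_const.sub continuous_id)).aestronglyMeasurable
    (vgauss_sub_le hτ2 s)
  simp only [smul_eq_mul, Pi.mul_apply, id] at h
  simp_rw [qM_eq_integral_vgauss, mul_assoc a]
  rw [integral_const_mul, h, div_mul_eq_mul_div, mul_div_assoc, ← integral_div]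
  congr 1
  refine setIntegral_congr_fun measurableSet_Ioi fun g hg => ?_
  have hg : 0 < g := hg
  rw [integral_vgauss_mul_vgauss_sub (pow_pos hg 2) hτ2, vgauss, mul_pow]
  have hpi := Real.pi_pos
  field_simp

theorem integral_qM_mul_vgauss_sub_smul_id (a : ℝ) {γ b τ : ℝ} (hγ : 1 < γ) (hb : b < 0)
    (c : ℝ) (hτ : 0 < τ) (s : Fin M → ℂ) :
    ∫ r, (qM a γ b c M r * vgauss M (τ ^ 2) (s - r)) • r =
      (a / Real.pi ^ M * nufun γ b c τ M (nsq s)) • s := by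
  have hτ2 : 0 < τ ^ 2 := pow_pos hτ 2
  have h := integral_mixture_smul (M := M) (F := fun r => vgauss M (τ ^ 2) (s - r) • r)
    ((measurable_id.pow_const (-γ)).mul (measurable_Qfun b c))
    (integrableOn_rpow_neg_mul_Qfun hb c hγ)
    (((continuous_vgauss _).comp (continuous_const.sub continuous_id)).smul
      continuous_id).aestronglyMeasurable
    (norm_vgauss_sub_smul_le hτ2 s)
  simp only [Pi.mul_apply, id] at h
  simp_rw [qM_eq_integral_vgauss, mul_smul]
  rw [integral_smul, h, ← mul_smul, div_mul_eq_mul_div, mul_div_assoc, mul_smul a]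
  congr 1
  rw [nufun, ← integral_div, ← integral_smul_const]
  refine setIntegral_congr_fun measurableSet_Ioi fun g hg => ?_
  have hg : 0 < g := hg
  have hpow : g ^ (2 - γ) = g ^ 2 * g ^ (-γ) := by
    rw [sub_eq_add_neg, Real.rpow_add hg, Real.rpow_two]
  simp only [smul_smul]
  rw [integral_vgauss_mul_vgauss_sub_smul_id (pow_pos hg 2) hτ2, smul_smul, vgauss, mul_pow,
    hpow]
  have hpi := Real.pi_pos
  congr 1
  field_simp
  ring

end ScaleMixture

/-- the vector MMSE denoiser for the prior `(1-λ)δ₀ + λ q_M` under complex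
Gaussian noise of variance `τ²` per antenna equals `r̃ · ν_M(‖r̃‖²)/ξ_M(‖r̃‖²)`. -/
theorem stmt11
    (M : ℕ) (hM : 1 ≤ M)
    (R α β σ : ℝ) (hR : 0 < R) (hβ : 0 < β) (hσ : 0 < σ)
    (γ a b c : ℝ)
    (hγ : γ = 40 / β + 1)
    (ha : a = 40 / (R ^ 2 * β * Real.sqrt Real.pi) *
      Real.exp (2 * (Real.log 10) ^ 2 * σ ^ 2 / β ^ 2 - 2 * (Real.log 10) * α / β))
    (hb : b = -10 * Real.sqrt 2 / ((Real.log 10) * σ))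
    (hc : c = (-α - β * Real.logb 10 R) / (Real.sqrt 2 * σ) - 20 / (β * b))
    (τ lam : ℝ) (hτ : 0 < τ) (hlam : lam ∈ Set.Ioo (0 : ℝ) 1)
    (rt : Fin M → ℂ)
    (m : ℝ)
    (hm : m = (1 - lam) * vgauss M (τ ^ 2) rt +
      lam * ∫ r : Fin M → ℂ, qM a γ b c M r * vgauss M (τ ^ 2) (rt - r)) :
    0 < m ∧
      m⁻¹ • (lam • ∫ r : Fin M → ℂ, (qM a γ b c M r * vgauss M (τ ^ 2) (rt - r)) • r) =
        (nufun γ b c τ M (nsq rt) / xifun a γ b c τ lam M (nsq rt)) • rt := by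
  obtain ⟨hlam0, hlam1⟩ := hlam
  have hlog : 0 < Real.log 10 := Real.log_pos (by norm_num)
  have hpi := Real.pi_pos
  have ha0 : 0 < a := by
    rw [ha]
    positivity
  have hb0 : b < 0 := by
    rw [hb]
    exact div_neg_of_neg_of_pos (by linarith [Real.sqrt_pos.2 (two_pos : (0 : ℝ) < 2)])
      (by positivity)
  have hγ1 : 1 < γ := by
    rw [hγ]
    linarith [div_pos (by norm_num : (0 : ℝ) < 40) hβ]
  have hτ2 : 0 < τ ^ 2 := pow_pos hτ 2
  have hm0 : 0 < m := by
    rw [hm]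
    refine add_pos_of_pos_of_nonneg (mul_pos (by linarith) (vgauss_pos hτ2 rt))
      (mul_nonneg hlam0.le (integral_nonneg fun r => ?_))
    exact mul_nonneg (qM_nonneg ha0.le γ b c r) (vgauss_pos hτ2 _).le
  have hmxi : m = lam * (a / Real.pi ^ M) * xifun a γ b c τ lam M (nsq rt) := by
    rw [hm, integral_qM_mul_vgauss_sub a hγ1 hb0 c hτ, xifun, vgauss, mul_add, mul_pow, ← pow_mul]
    congr 1
    · field_simp
    · ring
  refine ⟨hm0, ?_⟩
  have hxi : xifun a γ b c τ lam M (nsq rt) ≠ 0 := fun h => hm0.ne' (by rw [hmxi, h, mul_zero])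
  rw [integral_qM_mul_vgauss_sub_smul_id a hγ1 hb0 c hτ, smul_smul, smul_smul, hmxi]
  congr 1
  field_simp
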